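/- Let r ≥ 3 and let H be an r-uniform hypergraph with at least 3^r · r! + 1 edges. Then there exist constants b = b(H) > 0, c > 0 and an n_0 such that for all n ≥ n_0, C_r(n,H) ≥ c · n^b. -/

import Mathlib

open Finset

/-- A hypergraph on a finite set of natural-number vertices. -/
structure HGraph where
  verts : Finset ℕ
  edges : Finset (Finset ℕ)

/-- `H` is an `r`-uniform hypergraph. -/
def HGraph.IsUniform (H : HGraph) (r : ℕ) : Prop :=
  ∀ e ∈ H.edges, e ⊆ H.verts ∧ e.card = r

/-- `φ` determines a copy of `H` in the complete hypergraph on vertex set `range n`. -/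
def IsCopy (n : ℕ) (H : HGraph) (φ : ℕ → ℕ) : Prop :=
  Set.InjOn φ ↑H.verts ∧ ∀ v ∈ H.verts, φ v ∈ Finset.range n

/-- The family of edge-colourings `f v` with `k` colours is an `(n,r,H)`-local colouring:
for every copy of `H` there is a vertex of the copy whose colouring is rainbow on it. -/
def IsLocalColoring (n k : ℕ) (H : HGraph) (f : ℕ → Finset ℕ → Fin k) : Prop :=
  ∀ φ : ℕ → ℕ, IsCopy n H φ →
    ∃ x ∈ H.verts, ∀ e₁ ∈ H.edges, ∀ e₂ ∈ H.edges,
      f (φ x) (e₁.image φ) = f (φ x) (e₂.image φ) → e₁ = e₂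

/-- The local rainbow colouring number `C_r(n,H)`:
the least number of colours admitting an `(n,r,H)`-local colouring. -/
noncomputable def localC (n : ℕ) (H : HGraph) : ℕ :=
  sInf {k | ∃ f : ℕ → Finset ℕ → Fin k, IsLocalColoring n k H f}

/-- The Erdős–Rado sunflower lemma. -/
theorem exists_sunflower {α : Type*} [DecidableEq α] (k r : ℕ) (F : Finset (Finset α))
    (hF : ∀ A ∈ F, A.card = r) (hcard : k ^ r * r.factorial < F.card) :
    ∃ S ⊆ F, S.card = k + 1 ∧ ∃ D : Finset α, ∀ A ∈ S, ∀ B ∈ S, A ≠ B → A ∩ B = D := by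
  induction r generalizing F with
  | zero =>
    have hsub : F ⊆ {∅} := fun A hA => by
      rw [Finset.mem_singleton, ← Finset.card_eq_zero]
      exact hF A hA
    have := Finset.card_le_card hsub
    simp at hcard this
    omega
  | succ r ih =>
    by_cases hU : ∃ U : Finset α, U.card ≤ k * (r + 1) ∧ ∀ A ∈ F, (A ∩ U).Nonempty
    · obtain ⟨U, hUc, hU⟩ := hU
      obtain ⟨u, huU, hu⟩ : ∃ u ∈ U, k ^ r * r.factorial < (F.filter (u ∈ ·)).card := by
        by_contra! hcon
        have hsub : F ⊆ U.biUnion fun u => F.filter (u ∈ ·) := fun A hA => by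
          obtain ⟨u, hu⟩ := hU A hA
          rw [Finset.mem_inter] at hu
          exact Finset.mem_biUnion.2 ⟨u, hu.2, Finset.mem_filter.2 ⟨hA, hu.1⟩⟩
        have h1 := (Finset.card_le_card hsub).trans (Finset.card_biUnion_le_card_mul _ _ _ hcon)
        have h2 := h1.trans (Nat.mul_le_mul_right _ hUc)
        rw [Nat.factorial_succ, pow_succ] at hcard
        have h3 : k * (r + 1) * (k ^ r * r.factorial) = k ^ r * k * ((r + 1) * r.factorial) := by
          ring
        omega
      have hinj : Set.InjOn (fun A : Finset α => A.erase u) (F.filter (u ∈ ·)) := by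
        intro A hA B hB hAB
        simp only [Finset.coe_filter, Set.mem_ofPred_eq] at hA hB
        rw [← Finset.insert_erase hA.2, ← Finset.insert_erase hB.2]
        exact congrArg _ hAB
      obtain ⟨S, hS, hSc, D, hD⟩ := ih ((F.filter (u ∈ ·)).image fun A => A.erase u)
        (fun A hA => by
          obtain ⟨B, hB, rfl⟩ := Finset.mem_image.1 hA
          rw [Finset.mem_filter] at hB
          rw [Finset.card_erase_of_mem hB.2, hF B hB.1, Nat.add_sub_cancel])
        (by rwa [Finset.card_image_of_injOn hinj])
      have hSu : ∀ A ∈ S, u ∉ A ∧ insert u A ∈ F := fun A hA => by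
        obtain ⟨B, hB, rfl⟩ := Finset.mem_image.1 (hS hA)
        rw [Finset.mem_filter] at hB
        exact ⟨Finset.notMem_erase u B, by rw [Finset.insert_erase hB.2]; exact hB.1⟩
      refine ⟨S.image (insert u), ?_, ?_, insert u D, ?_⟩
      · intro A hA
        obtain ⟨B, hB, rfl⟩ := Finset.mem_image.1 hA
        exact (hSu B hB).2
      · rw [Finset.card_image_of_injOn, hSc]
        intro A hA B hB hAB
        rw [← Finset.erase_insert (hSu A hA).1, ← Finset.erase_insert (hSu B hB).1]
        exact congrArg (Finset.erase · u) hAB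
      · intro A hA B hB hAB
        obtain ⟨A', hA', rfl⟩ := Finset.mem_image.1 hA
        obtain ⟨B', hB', rfl⟩ := Finset.mem_image.1 hB
        rw [← Finset.insert_inter_distrib, hD A' hA' B' hB' fun h => hAB (h ▸ rfl)]
    · push Not at hU
      have greedy : ∀ j ≤ k + 1, ∃ S ⊆ F, S.card = j ∧
          ∀ A ∈ S, ∀ B ∈ S, A ≠ B → A ∩ B = ∅ := by
        intro j
        induction j with
        | zero => exact fun _ => ⟨∅, by simp⟩
        | succ j ihj =>
          intro hj
          obtain ⟨S, hS, hSc, hd⟩ := ihj (by omega)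
          obtain ⟨A, hA, hAU⟩ := hU (S.biUnion id)
            ((Finset.card_biUnion_le_card_mul S id (r + 1) fun B hB => (hF B (hS hB)).le).trans
              (Nat.mul_le_mul_right _ (by omega)))
          have hAd : ∀ B ∈ S, A ∩ B = ∅ := fun B hB =>
            Finset.subset_empty.1 (hAU ▸ Finset.inter_subset_inter_left
              (Finset.subset_biUnion_of_mem id hB))
          have hAS : A ∉ S := fun h => by
            have hA0 := hAd A h
            rw [Finset.inter_self] at hA0
            have hAc := hF A hA
            rw [hA0, Finset.card_empty] at hAc
            omega
          refine ⟨insert A S, Finset.insert_subset hA hS, by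
            rw [Finset.card_insert_of_notMem hAS, hSc], ?_⟩
          intro B hB C hC hBC
          rw [Finset.mem_insert] at hB hC
          obtain rfl | hB := hB <;> obtain rfl | hC := hC
          · exact absurd rfl hBC
          · exact hAd C hC
          · rw [Finset.inter_comm]
            exact hAd B hB
          · exact hd B hB C hC hBC
      obtain ⟨S, hS, hSc, hd⟩ := greedy (k + 1) le_rfl
      exact ⟨S, hS, hSc, ∅, hd⟩

/-- A colouring of a large complete bipartite graph contains a monochromatic four-cycle, whose
vertices on the larger side may moreover be required to agree under a vertex colouring `σ`. -/
theorem exists_monochromatic_four_cycle {C S : Type*} [Fintype C] [Fintype S]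
    (c : ℕ → ℕ → C) (σ : ℕ → S) :
    ∃ a₁ a₂ b₁ b₂ : ℕ, a₁ < a₂ ∧ a₂ < b₁ ∧ b₁ < b₂ ∧
      b₂ < Fintype.card C + 2 + (Fintype.card C + 1) ^ 2 * Fintype.card C * Fintype.card S ∧
      c a₁ b₁ = c a₂ b₁ ∧ c a₁ b₂ = c a₂ b₂ ∧ c a₁ b₁ = c a₁ b₂ ∧ c a₂ b₁ = c a₂ b₂ ∧
      σ b₁ = σ b₂ := by
  set q := Fintype.card C with hq
  have hpair : ∀ b, ∃ x y : Fin (q + 1), x < y ∧ c x b = c y b := by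
    intro b
    obtain ⟨x, y, hxy, h⟩ := Fintype.exists_ne_map_eq_of_card_lt
      (fun x : Fin (q + 1) => c x b) (by simp [← hq])
    rcases lt_or_gt_of_ne hxy with h' | h'
    · exact ⟨x, y, h', h⟩
    · exact ⟨y, x, h', h.symm⟩
  choose x y hxy hc using hpair
  obtain ⟨i, j, hij, h⟩ := Fintype.exists_ne_map_eq_of_card_lt
    (fun i : Fin ((q + 1) ^ 2 * q * Fintype.card S + 1) =>
      ((x (q + 1 + i), y (q + 1 + i)), c (x (q + 1 + i)) (q + 1 + i), σ (q + 1 + i)))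
    (by simp [← hq]; apply le_of_eq; ring)
  wlog hlt : i < j generalizing i j
  · exact this j i hij.symm h.symm (lt_of_le_of_ne (not_lt.1 hlt) hij.symm)
  simp only [Prod.mk.injEq] at h
  obtain ⟨⟨hx, hy⟩, hcc, hσ⟩ := h
  have h1 := hc (q + 1 + i)
  have h2 := hc (q + 1 + j)
  rw [← hx, ← hy] at h2
  rw [← hx] at hcc
  have := (y (q + 1 + i)).isLt
  have := j.isLt
  have := hxy (q + 1 + i)
  refine ⟨x (q + 1 + i), y (q + 1 + i), q + 1 + i, q + 1 + j, this, by omega, by omega, by omega,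
    h1, h2, hcc, ?_, hσ⟩
  rw [← h1, ← h2, hcc]

/-- The `p`-th of the consecutive blocks of length `s` following the first `m` integers. -/
def block (m s p : ℕ) : Finset ℕ :=
  (Finset.range s).image fun j => m + (p * s + j)

/-- Disjoint `s`-sets below `m` can be moved into prescribed blocks, fixing all other points. -/
theorem exists_map_onto_blocks {ι : Type*} (m s : ℕ) (Q : ι → Finset ℕ)
    (hQ : ∀ i, (Q i).card = s) (hdisj : ∀ i j, i ≠ j → Disjoint (Q i) (Q j))
    (p : ι → ℕ) (hp : Function.Injective p) :
    ∃ φ : ℕ → ℕ, Set.InjOn φ ↑(Finset.range m) ∧ (∀ v, (∀ i, v ∉ Q i) → φ v = v) ∧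
      ∀ i, (Q i).image φ = block m s (p i) := by
  classical
  let σ : ∀ i, Q i ≃ Fin s := fun i => (Q i).equivFinOfCardEq (hQ i)
  let φ : ℕ → ℕ := fun v =>
    if h : ∃ i, v ∈ Q i then m + (p h.choose * s + σ h.choose ⟨v, h.choose_spec⟩) else v
  have hφ : ∀ i v (hv : v ∈ Q i), φ v = m + (p i * s + σ i ⟨v, hv⟩) := by
    intro i v hv
    have h : ∃ i, v ∈ Q i := ⟨i, hv⟩
    have hi : h.choose = i := by
      by_contra hne
      exact Finset.disjoint_left.1 (hdisj _ _ hne) h.choose_spec hv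
    have key : ∀ i' (hv' : v ∈ Q i'), i' = i →
        m + (p i' * s + (σ i' ⟨v, hv'⟩ : ℕ)) = m + (p i * s + σ i ⟨v, hv⟩) := by
      rintro i' hv' rfl
      rfl
    simp only [φ, dif_pos h]
    exact key _ h.choose_spec hi
  have hφ' : ∀ v, (∀ i, v ∉ Q i) → φ v = v := fun v hv => by
    simp only [φ]
    rw [dif_neg (by simpa using hv)]
  refine ⟨φ, ?_, hφ', ?_⟩
  · intro v hv w hw hvw
    rw [Finset.mem_coe, Finset.mem_range] at hv hw
    by_cases h1 : ∃ i, v ∈ Q i <;> by_cases h2 : ∃ i, w ∈ Q i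
    · obtain ⟨i, hi⟩ := h1
      obtain ⟨j, hj⟩ := h2
      rw [hφ i v hi, hφ j w hj, Nat.add_left_cancel_iff] at hvw
      have li := (σ i ⟨v, hi⟩).isLt
      have lj := (σ j ⟨w, hj⟩).isLt
      have hpos : 0 < s := by omega
      have hdiv := congrArg (· / s) hvw
      simp only [Nat.mul_comm _ s, Nat.mul_add_div hpos, Nat.div_eq_of_lt li,
        Nat.div_eq_of_lt lj, Nat.add_zero] at hdiv
      obtain rfl := hp hdiv
      have : σ i ⟨v, hi⟩ = σ i ⟨w, hj⟩ := Fin.ext (by omega)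
      simpa using this
    · obtain ⟨i, hi⟩ := h1
      rw [hφ i v hi, hφ' w (by simpa using h2)] at hvw
      omega
    · obtain ⟨i, hi⟩ := h2
      rw [hφ i w hi, hφ' v (by simpa using h1)] at hvw
      omega
    · rwa [hφ' v (by simpa using h1), hφ' w (by simpa using h2)] at hvw
  · intro i
    ext z
    simp only [block, Finset.mem_image, Finset.mem_range]
    constructor
    · rintro ⟨v, hv, rfl⟩
      exact ⟨σ i ⟨v, hv⟩, (σ i ⟨v, hv⟩).isLt, (hφ i v hv).symm⟩
    · rintro ⟨j, hj, rfl⟩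
      refine ⟨(σ i).symm ⟨j, hj⟩, ((σ i).symm ⟨j, hj⟩).2, ?_⟩
      rw [hφ i _ ((σ i).symm ⟨j, hj⟩).2]
      simp

/-- If `H` contains a sunflower with four petals of size `s`, then the number of colours of a
local colouring bounds the number of vertices polynomially. -/
theorem IsLocalColoring.lt_of_sunflower {n k m s : ℕ} {H : HGraph} {f : ℕ → Finset ℕ → Fin k}
    (hf : IsLocalColoring n k H f) (hm : H.verts ⊆ Finset.range m)
    (A : Fin 4 → Finset ℕ) (D : Finset ℕ) (hA : ∀ i, A i ∈ H.edges)
    (hAinj : Function.Injective A) (hAD : ∀ i j, i ≠ j → A i ∩ A j = D)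
    (hs : ∀ i, (A i \ D).card = s) :
    n < m + s * ((k * k) ^ s + 2 + ((k * k) ^ s + 1) ^ 2 * (k * k) ^ s * k ^ m) := by
  by_contra! hn
  obtain ⟨a₁, a₂, b₁, b₂, ha, hab, hb, hbN, h1, h2, h3, h4, hσ⟩ :=
    exists_monochromatic_four_cycle
      (fun p q (j : Fin s) => (f (m + (p * s + j)) (D ∪ block m s q),
        f (m + (q * s + j)) (D ∪ block m s p)))
      (fun p (v : Fin m) => f v (D ∪ block m s p))
  simp only [Fintype.card_fun, Fintype.card_prod, Fintype.card_fin] at hbN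
  have hDA : ∀ i, D ⊆ A i := by
    intro i
    obtain ⟨j, hj⟩ := exists_ne i
    rw [← hAD i j hj.symm]
    exact Finset.inter_subset_left
  have hdisj : ∀ i j, i ≠ j → Disjoint (A i \ D) (A j \ D) := by
    intro i j hij
    rw [Finset.disjoint_left]
    intro v hv hw
    rw [Finset.mem_sdiff] at hv hw
    exact hv.2 (hAD i j hij ▸ Finset.mem_inter.2 ⟨hv.1, hw.1⟩)
  let p : Fin 4 → ℕ := ![a₁, a₂, b₁, b₂]
  have hpm : StrictMono p := by
    rw [Fin.strictMono_iff_lt_succ]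
    intro i
    fin_cases i
    exacts [ha, hab, hb]
  obtain ⟨φ, hφinj, hφfix, hφim⟩ :=
    exists_map_onto_blocks m s (fun i => A i \ D) hs hdisj p hpm.injective
  have hφA : ∀ i, (A i).image φ = D ∪ block m s (p i) := by
    intro i
    have hD : D.image φ = D := by
      refine (Finset.image_congr (g := id) fun v hv => hφfix v fun i hi => ?_).trans
        Finset.image_id
      exact (Finset.mem_sdiff.1 hi).2 hv
    rw [← hφim, ← Finset.union_sdiff_of_subset (hDA i), Finset.image_union, hD,
      Finset.union_sdiff_of_subset (hDA i)]
  have hφQ : ∀ i, ∀ v ∈ A i \ D, ∃ j : Fin s, φ v = m + (p i * s + j) := by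
    intro i v hv
    have := Finset.mem_image_of_mem φ hv
    rw [hφim] at this
    simp only [block, Finset.mem_image, Finset.mem_range] at this
    obtain ⟨j, hj, h⟩ := this
    exact ⟨⟨j, hj⟩, h.symm⟩
  have hcopy : IsCopy n H φ := by
    refine ⟨hφinj.mono (by exact_mod_cast hm), fun v hv => ?_⟩
    rw [Finset.mem_range]
    refine lt_of_lt_of_le ?_ hn
    have hvm := Finset.mem_range.1 (hm hv)
    by_cases h : ∃ i, v ∈ A i \ D
    · obtain ⟨i, hi⟩ := h
      obtain ⟨j, hj⟩ := hφQ i v hi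
      have hpi : p i + 1 ≤ _ := (hpm.monotone (Fin.le_last i)).trans_lt hbN
      have := Nat.mul_le_mul_left s hpi
      have := j.isLt
      rw [hj]
      linarith
    · rw [hφfix v (by simpa using h)]
      omega
  obtain ⟨x, hx, hrb⟩ := hf φ hcopy
  have hne : ∀ i j, i ≠ j →
      f (φ x) (D ∪ block m s (p i)) ≠ f (φ x) (D ∪ block m s (p j)) := by
    intro i j hij h
    rw [← hφA, ← hφA] at h
    exact hij (hAinj (hrb _ (hA i) _ (hA j) h))
  by_cases h : ∃ i, x ∈ A i \ D
  · obtain ⟨i, hi⟩ := h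
    obtain ⟨j, hj⟩ := hφQ i x hi
    rw [hj] at hne
    fin_cases i
    · exact hne 2 3 (by decide) (congrArg Prod.fst (congrFun h3 j))
    · exact hne 2 3 (by decide) (congrArg Prod.fst (congrFun h4 j))
    · exact hne 0 1 (by decide) (congrArg Prod.snd (congrFun h1 j))
    · exact hne 0 1 (by decide) (congrArg Prod.snd (congrFun h2 j))
  · rw [hφfix x (by simpa using h)] at hne
    exact hne 2 3 (by decide) (congrFun hσ ⟨x, Finset.mem_range.1 (hm hx)⟩)

/-- Local colourings exist, as one may give all edges different colours. -/
theorem exists_isLocalColoring (n : ℕ) (H : HGraph) (hv : H.verts.Nonempty)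
    (he : ∀ e ∈ H.edges, e ⊆ H.verts) :
    ∃ k, ∃ f : ℕ → Finset ℕ → Fin k, IsLocalColoring n k H f := by
  obtain ⟨x, hx⟩ := hv
  let g := Fintype.equivFin (Finset.range n).powerset
  refine ⟨_, fun _ e => g ⟨e ∩ Finset.range n, Finset.mem_powerset.2 Finset.inter_subset_right⟩,
    fun φ hφ => ⟨x, hx, fun e₁ h₁ e₂ h₂ h => ?_⟩⟩
  have hsub : ∀ e ∈ H.edges, e.image φ ∩ Finset.range n = e.image φ := fun e h =>
    Finset.inter_eq_left.2 (Finset.image_subset_iff.2 fun v hv => hφ.2 v (he e h hv))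
  have h' := congrArg Subtype.val (g.injective h)
  simp only [hsub e₁ h₁, hsub e₂ h₂] at h'
  rw [← Finset.coe_inj, Finset.coe_image, Finset.coe_image,
    hφ.1.image_eq_image_iff (by exact_mod_cast he e₁ h₁) (by exact_mod_cast he e₂ h₂)] at h'
  exact_mod_cast h'

theorem stmt_16 (r : ℕ) (hr : 3 ≤ r) (H : HGraph) (hH : H.IsUniform r)
    (hcard : 3 ^ r * Nat.factorial r + 1 ≤ H.edges.card) :
    ∃ b : ℝ, 0 < b ∧ ∃ c : ℝ, 0 < c ∧ ∃ n₀ : ℕ, ∀ n : ℕ, n₀ ≤ n →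
      c * (n : ℝ) ^ b ≤ (localC n H : ℝ) := by
  obtain ⟨S, hSH, hSc, D, hD⟩ := exists_sunflower 3 r H.edges (fun A hA => (hH A hA).2) hcard
  let A : Fin 4 → Finset ℕ := fun i => ((S.equivFinOfCardEq hSc).symm i : Finset ℕ)
  have hAS : ∀ i, A i ∈ S := fun i => ((S.equivFinOfCardEq hSc).symm i).2
  have hAinj : Function.Injective A :=
    Subtype.val_injective.comp (S.equivFinOfCardEq hSc).symm.injective
  have hAH : ∀ i, A i ∈ H.edges := fun i => hSH (hAS i)
  have hAD : ∀ i j, i ≠ j → A i ∩ A j = D := fun i j hij =>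
    hD _ (hAS i) _ (hAS j) (hAinj.ne hij)
  have hs : ∀ i, (A i \ D).card = r - D.card := by
    intro i
    obtain ⟨j, hj⟩ := exists_ne i
    rw [Finset.card_sdiff_of_subset, (hH _ (hAH i)).2]
    rw [← hAD i j hj.symm]
    exact Finset.inter_subset_left
  set s := r - D.card
  have hvne : H.verts.Nonempty := by
    have h0 : (A 0).Nonempty := by
      rw [← Finset.card_pos, (hH _ (hAH 0)).2]
      omega
    exact h0.mono (hH _ (hAH 0)).1
  obtain ⟨m, hm⟩ : ∃ m, H.verts ⊆ Finset.range m := Finset.exists_nat_subset_range _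
  have hmpos : 0 < m := by
    obtain ⟨v, hv⟩ := hvne
    exact Nat.pos_of_ne_zero fun h => by simpa [h] using hm hv
  have hE : (0 : ℝ) < (6 * s + m : ℕ) := by
    exact_mod_cast (by omega : 0 < 6 * s + m)
  have hC : (0 : ℝ) < (m + 7 * s : ℕ) := by
    exact_mod_cast (by omega : 0 < m + 7 * s)
  have hbound : ∀ n, n ≤ (m + 7 * s) * localC n H ^ (6 * s + m) := by
    intro n
    obtain ⟨f, hf⟩ := Nat.sInf_mem (exists_isLocalColoring n H hvne fun e he => (hH e he).1)
    change IsLocalColoring n (localC n H) H f at hf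
    have hk : 0 < localC n H := (f 0 ∅).pos
    have hlt := hf.lt_of_sunflower hm A D hAH hAinj hAD hs
    generalize localC n H = k at hk hlt
    have hq : 1 ≤ (k * k) ^ s := Nat.one_le_pow _ _ (Nat.mul_pos hk hk)
    have hw : 1 ≤ k ^ m := Nat.one_le_pow _ _ hk
    have hpow : k ^ (6 * s + m) = ((k * k) ^ s) ^ 3 * k ^ m := by
      rw [← pow_two, ← pow_mul, ← pow_mul, ← pow_add]
      ring_nf
    rw [hpow]
    generalize (k * k) ^ s = q at hq hlt
    generalize k ^ m = w at hw hlt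
    have hq3 : q ≤ q ^ 3 := Nat.le_self_pow (by norm_num) q
    have hq3w : q ^ 3 ≤ q ^ 3 * w := Nat.le_mul_of_pos_right _ hw
    have hsq : (q + 1) ^ 2 * q * w ≤ 4 * (q ^ 3 * w) := by
      calc (q + 1) ^ 2 * q * w ≤ (2 * q) ^ 2 * q * w := by gcongr; omega
        _ = 4 * (q ^ 3 * w) := by ring
    have hN : q + 2 + (q + 1) ^ 2 * q * w ≤ 7 * (q ^ 3 * w) := by omega
    calc n ≤ m + s * (q + 2 + (q + 1) ^ 2 * q * w) := hlt.le
      _ ≤ m * (q ^ 3 * w) + s * (7 * (q ^ 3 * w)) := by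
        gcongr
        exact Nat.le_mul_of_pos_right _ (by omega)
      _ = (m + 7 * s) * (q ^ 3 * w) := by ring
  refine ⟨((6 * s + m : ℕ) : ℝ)⁻¹, inv_pos.2 hE,
    (((m + 7 * s : ℕ) : ℝ) ^ ((6 * s + m : ℕ) : ℝ)⁻¹)⁻¹, inv_pos.2 (Real.rpow_pos_of_pos hC _),
    0, fun n _ => ?_⟩
  rw [inv_mul_le_iff₀ (Real.rpow_pos_of_pos hC _)]
  have hcast : (n : ℝ) ≤ (m + 7 * s : ℕ) * (localC n H : ℝ) ^ (6 * s + m) := by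
    exact_mod_cast hbound n
  calc (n : ℝ) ^ ((6 * s + m : ℕ) : ℝ)⁻¹
      ≤ ((m + 7 * s : ℕ) * (localC n H : ℝ) ^ (6 * s + m)) ^ ((6 * s + m : ℕ) : ℝ)⁻¹ :=
        Real.rpow_le_rpow (Nat.cast_nonneg _) hcast (inv_nonneg.2 hE.le)
    _ = _ := by
        rw [Real.mul_rpow hC.le (by positivity),
          Real.pow_rpow_inv_natCast (Nat.cast_nonneg _) (by omega)]
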